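/- arXiv:1509.03671 — 9 statements merged into one kernel-verified Lean document; each statement's English description precedes it below -/
import Mathlib

section
/- (Compactness Theorem) For every set Γ of formulas of propositional team logic and every formula φ: if Γ ⊨ φ, then there exists a finite subset Δ ⊆ Γ such that Δ ⊨ φ. -/
inductive PTForm : Type
  | var : ℕ → PTForm
  | bot : PTForm
  | top : PTForm
  | neg : PTForm → PTForm
  | conj : PTForm → PTForm → PTForm
  | tensor : PTForm → PTForm → PTForm
  | disj : PTForm → PTForm → PTForm
  | impl : PTForm → PTForm → PTForm
  | dep : List PTForm → PTForm → PTForm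

abbrev Val := ℕ → Bool
abbrev Team := Set Val

def PTSat : Team → PTForm → Prop
  | X, .var n => ∀ v ∈ X, v n = true
  | X, .bot => X = ∅
  | _, .top => True
  | X, .neg φ => ∀ v ∈ X, ¬ PTSat {v} φ
  | X, .conj φ ψ => PTSat X φ ∧ PTSat X ψ
  | X, .tensor φ ψ => ∃ Y Z, X = Y ∪ Z ∧ PTSat Y φ ∧ PTSat Z ψ
  | X, .disj φ ψ => PTSat X φ ∨ PTSat X ψ
  | X, .impl φ ψ => ∀ Y ⊆ X, PTSat Y φ → PTSat Y ψ
  | X, .dep l ψ => ∀ Y ⊆ X,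
      (∀ φ ∈ l, PTSat Y φ ∨ (∀ v ∈ Y, ¬ PTSat {v} φ)) →
      (PTSat Y ψ ∨ (∀ v ∈ Y, ¬ PTSat {v} ψ))

def PTValid (φ : PTForm) : Prop := ∀ X : Team, PTSat X φ
def PTConseq (φ ψ : PTForm) : Prop := ∀ X : Team, PTSat X φ → PTSat X ψ
def PTEquiv (φ ψ : PTForm) : Prop := ∀ X : Team, PTSat X φ ↔ PTSat X ψ
def PTSetConseq (Γ : Set PTForm) (φ : PTForm) : Prop :=
  ∀ X : Team, (∀ ψ ∈ Γ, PTSat X ψ) → PTSat X φ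
def Flat (φ : PTForm) : Prop :=
  ∀ X : Team, PTSat X φ ↔ ∀ v ∈ X, PTSat {v} φ

/-- All propositional variables of a formula are among `p_0, …, p_{n-1}`. -/
def VarsBelow (n : ℕ) : PTForm → Prop
  | .var m => m < n
  | .bot => True
  | .top => True
  | .neg φ => VarsBelow n φ
  | .conj φ ψ => VarsBelow n φ ∧ VarsBelow n ψ
  | .tensor φ ψ => VarsBelow n φ ∧ VarsBelow n ψ
  | .disj φ ψ => VarsBelow n φ ∧ VarsBelow n ψ
  | .impl φ ψ => VarsBelow n φ ∧ VarsBelow n ψ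
  | .dep l ψ => (∀ φ ∈ l, VarsBelow n φ) ∧ VarsBelow n ψ

/-- The restriction of a valuation to the variables `p_0, …, p_{n-1}`. -/
def restrict (n : ℕ) (v : Val) : Fin n → Bool := fun i => v i.val

/-- The team of all valuations whose restriction to `p_0, …, p_{n-1}` lies in
a given team on those variables. -/
def liftTeam (n : ℕ) (Y : Set (Fin n → Bool)) : Team :=
  {w : Val | restrict n w ∈ Y}

/-- Finite intuitionistic disjunction (`⊥` for the empty list). -/
def bigDisj (l : List PTForm) : PTForm := l.foldr .disj .bot

/-- Finite tensor disjunction (`⊥` for the empty list). -/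
def bigTensor (l : List PTForm) : PTForm := l.foldr .tensor .bot

/-- The conjunction `p_0^{v(p_0)} ∧ … ∧ p_{n-1}^{v(p_{n-1})}`,
where `p¹ = p` and `p⁰ = ¬p`. -/
def literal (n : ℕ) (v : Fin n → Bool) : PTForm :=
  (List.finRange n).foldr
    (fun i acc => .conj (if v i then .var i.val else .neg (.var i.val)) acc) .top

open Classical in
/-- `Θ_X := ¬¬⋁_{v∈X} (p_0^{v(p_0)} ∧ … ∧ p_{n-1}^{v(p_{n-1})})` for a nonempty
team `X` on `p_0, …, p_{n-1}`, and `Θ_∅ := ⊥`. -/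
noncomputable def Theta (n : ℕ) (X : Set (Fin n → Bool)) : PTForm :=
  if X = ∅ then .bot
  else .neg (.neg (bigDisj (X.toFinite.toFinset.toList.map (literal n))))

/-- `Θ⊗_X := ⨂_{v∈X} (p_0^{v(p_0)} ∧ … ∧ p_{n-1}^{v(p_{n-1})})`
(the tensor normal form; `⊥` for `X = ∅`). -/
noncomputable def ThetaTensor (n : ℕ) (X : Set (Fin n → Bool)) : PTForm :=
  bigTensor (X.toFinite.toFinset.toList.map (literal n))

abbrev Subst := ℕ → PTForm

def applySubst (σ : Subst) : PTForm → PTForm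
  | .var n => σ n
  | .bot => .bot
  | .top => .top
  | .neg φ => .neg (applySubst σ φ)
  | .conj φ ψ => .conj (applySubst σ φ) (applySubst σ ψ)
  | .tensor φ ψ => .tensor (applySubst σ φ) (applySubst σ ψ)
  | .disj φ ψ => .disj (applySubst σ φ) (applySubst σ ψ)
  | .impl φ ψ => .impl (applySubst σ φ) (applySubst σ ψ)
  | .dep l ψ => .dep (l.attach.map (fun x => applySubst σ x.1)) (applySubst σ ψ)
decreasing_by
  all_goals simp_wf
  all_goals first
    | (have := List.sizeOf_lt_of_mem x.2; omega)
    | omega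

def FlatSubst (σ : Subst) : Prop := ∀ n : ℕ, Flat (σ n)

open Classical in
noncomputable def valSub (σ : Subst) (v : Val) : Val :=
  fun p => if PTSat {v} (σ p) then true else false

noncomputable def teamSub (σ : Subst) (X : Team) : Team := valSub σ '' X

/-- A formula is F-projective if some flat substitution unifies it and is,
modulo the formula, the identity on variables. -/
def FProjective (φ : PTForm) : Prop :=
  ∃ σ : Subst, FlatSubst σ ∧ PTValid (applySubst σ φ) ∧
    ∀ p : ℕ,
      (∀ X : Team, PTSat X φ → PTSat X (σ p) → PTSat X (.var p)) ∧
      (∀ X : Team, PTSat X φ → PTSat X (.var p) → PTSat X (σ p))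

/-- Prucnal's substitution determined by a formula `θ` and a valuation `v` on
`p_0, …, p_{n-1}`: `σ(p) = θ ∧ p` if `v(p) = 0` and `σ(p) = θ → p` if
`v(p) = 1` (identity outside the domain of `v`). -/
def prucnal (θ : PTForm) (n : ℕ) (v : Fin n → Bool) : Subst :=
  fun p => if h : p < n then
      (if v ⟨p, h⟩ then .impl θ (.var p) else .conj θ (.var p))
    else .var p

/-- The variant of Prucnal's substitution used for the tensor normal form:
`σ(p) = θ ∧ p` if `v(p) = 0` and `σ(p) = ¬θ ⊗ p` if `v(p) = 1`. -/
def prucnalT (θ : PTForm) (n : ℕ) (v : Fin n → Bool) : Subst :=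
  fun p => if h : p < n then
      (if v ⟨p, h⟩ then .tensor (.neg θ) (.var p) else .conj θ (.var p))
    else .var p

/-- A formula contains no dependence atoms and no intuitionistic disjunction. -/
def IsClassical : PTForm → Prop
  | .var _ => True
  | .bot => True
  | .top => True
  | .neg φ => IsClassical φ
  | .conj φ ψ => IsClassical φ ∧ IsClassical ψ
  | .tensor φ ψ => IsClassical φ ∧ IsClassical ψ
  | .disj _ _ => False
  | .impl φ ψ => IsClassical φ ∧ IsClassical ψ
  | .dep _ _ => False

/-- Classical truth-table satisfaction by a single valuation, reading `⊗` as
classical disjunction. -/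
def CSat (v : Val) : PTForm → Prop
  | .var n => v n = true
  | .bot => False
  | .top => True
  | .neg φ => ¬ CSat v φ
  | .conj φ ψ => CSat v φ ∧ CSat v ψ
  | .tensor φ ψ => CSat v φ ∨ CSat v ψ
  | .disj φ ψ => CSat v φ ∨ CSat v ψ
  | .impl φ ψ => CSat v φ → CSat v ψ
  | .dep _ _ => True

/-- Formulas of propositional dependence logic (PD): atoms `p`, `¬p`, `⊥`, `⊤`,
dependence atoms with variable arguments, conjunction and tensor. -/
inductive PDForm : Type
  | pos : ℕ → PDForm
  | negv : ℕ → PDForm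
  | bot : PDForm
  | top : PDForm
  | dep : List ℕ → ℕ → PDForm
  | conj : PDForm → PDForm → PDForm
  | tensor : PDForm → PDForm → PDForm

/-- The embedding of PD formulas into PT formulas. -/
def PDForm.toPT : PDForm → PTForm
  | .pos n => .var n
  | .negv n => .neg (.var n)
  | .bot => .bot
  | .top => .top
  | .dep l q => .dep (l.map .var) (.var q)
  | .conj φ ψ => .conj φ.toPT ψ.toPT
  | .tensor φ ψ => .tensor φ.toPT ψ.toPT

/-- The syntactic (De Morgan) negation `φ~` of a PD formula. -/
def PDForm.synNeg : PDForm → PDForm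
  | .pos n => .negv n
  | .negv n => .pos n
  | .bot => .top
  | .top => .bot
  | .dep _ _ => .bot
  | .conj φ ψ => .tensor φ.synNeg ψ.synNeg
  | .tensor φ ψ => .conj φ.synNeg ψ.synNeg

/-- Structural induction on formulas, with the induction hypothesis for every argument of a
dependence atom. -/
theorem PTForm.structural_induction {P : PTForm → Prop}
    (var : ∀ n, P (.var n)) (bot : P .bot) (top : P .top)
    (neg : ∀ φ, P φ → P (.neg φ))
    (conj : ∀ φ ψ, P φ → P ψ → P (.conj φ ψ))
    (tensor : ∀ φ ψ, P φ → P ψ → P (.tensor φ ψ))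
    (disj : ∀ φ ψ, P φ → P ψ → P (.disj φ ψ))
    (impl : ∀ φ ψ, P φ → P ψ → P (.impl φ ψ))
    (dep : ∀ l ψ, (∀ φ ∈ l, P φ) → P ψ → P (.dep l ψ)) (φ : PTForm) : P φ :=
  PTForm.rec (motive_1 := P) (motive_2 := fun l => ∀ φ ∈ l, P φ)
    var bot top neg conj tensor disj impl dep (by simp)
    (fun _ _ hφ hl => List.forall_mem_cons.2 ⟨hφ, hl⟩) φ

theorem VarsBelow.mono {m n : ℕ} (hmn : m ≤ n) (φ : PTForm) :
    VarsBelow m φ → VarsBelow n φ := by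
  induction φ using PTForm.structural_induction with
  | var k => simpa only [VarsBelow] using fun h => lt_of_lt_of_le h hmn
  | bot | top => simp [VarsBelow]
  | neg φ ih => simpa only [VarsBelow] using ih
  | conj φ ψ ihφ ihψ | tensor φ ψ ihφ ihψ | disj φ ψ ihφ ihψ | impl φ ψ ihφ ihψ =>
    simpa only [VarsBelow] using And.imp ihφ ihψ
  | dep l ψ ihl ihψ =>
    simpa only [VarsBelow] using And.imp (fun h φ hφ => ihl φ hφ (h φ hφ)) ihψ

theorem exists_varsBelow (φ : PTForm) : ∃ n, VarsBelow n φ := by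
  have both {φ ψ : PTForm} : (∃ n, VarsBelow n φ) → (∃ n, VarsBelow n ψ) →
      ∃ n, VarsBelow n φ ∧ VarsBelow n ψ := fun ⟨m, hm⟩ ⟨n, hn⟩ =>
    ⟨max m n, hm.mono (le_max_left m n), hn.mono (le_max_right m n)⟩
  induction φ using PTForm.structural_induction with
  | var k => exact ⟨k + 1, by simp [VarsBelow]⟩
  | bot | top => exact ⟨0, by simp [VarsBelow]⟩
  | neg φ ih => simpa only [VarsBelow] using ih
  | conj φ ψ ihφ ihψ | tensor φ ψ ihφ ihψ | disj φ ψ ihφ ihψ | impl φ ψ ihφ ihψ =>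
    simpa only [VarsBelow] using both ihφ ihψ
  | dep l ψ ihl ihψ =>
    have hl : ∃ n, ∀ φ ∈ l, VarsBelow n φ := by
      clear ihψ
      induction l with
      | nil => exact ⟨0, by simp⟩
      | cons φ l ih =>
        obtain ⟨m, hm⟩ := ihl φ (by simp)
        obtain ⟨n, hn⟩ := ih fun χ hχ => ihl χ (List.mem_cons_of_mem φ hχ)
        exact ⟨max m n, List.forall_mem_cons.2
          ⟨hm.mono (le_max_left m n), fun χ hχ => (hn χ hχ).mono (le_max_right m n)⟩⟩
    obtain ⟨m, hm⟩ := hl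
    obtain ⟨n, hn⟩ := ihψ
    refine ⟨max m n, ?_⟩
    simp only [VarsBelow]
    exact ⟨fun φ hφ => (hm φ hφ).mono (le_max_left m n), hn.mono (le_max_right m n)⟩

theorem image_restrict_sep {n : ℕ} {X X' Y : Team} (h : restrict n '' X = restrict n '' X')
    (hY : Y ⊆ X) :
    restrict n '' {v ∈ X' | restrict n v ∈ restrict n '' Y} = restrict n '' Y := by
  ext w
  constructor
  · rintro ⟨v, hv, rfl⟩
    exact hv.2
  · intro hw
    obtain ⟨v, hv, rfl⟩ := h ▸ Set.image_mono hY hw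
    exact ⟨v, ⟨hv, hw⟩, rfl⟩

theorem forall_mem_not_ptSat_of_image_restrict_eq {n : ℕ} {φ : PTForm}
    (hφ : ∀ X X' : Team, restrict n '' X = restrict n '' X' → PTSat X φ → PTSat X' φ)
    {X X' : Team} (h : restrict n '' X = restrict n '' X')
    (hX : ∀ v ∈ X, ¬ PTSat {v} φ) : ∀ v ∈ X', ¬ PTSat {v} φ := by
  intro v hv hsat
  obtain ⟨u, hu, huv⟩ := h ▸ Set.mem_image_of_mem (restrict n) hv
  exact hX u hu (hφ {v} {u} (by simp [huv]) hsat)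

/-- Locality: satisfaction depends only on the restriction of the team to the variables
of the formula. -/
theorem PTSat.of_image_restrict_eq {n : ℕ} (φ : PTForm) :
    VarsBelow n φ → ∀ X X' : Team, restrict n '' X = restrict n '' X' →
      PTSat X φ → PTSat X' φ := by
  induction φ using PTForm.structural_induction with
  | var k =>
    intro hk X X' h
    simp only [PTSat, VarsBelow] at hk ⊢
    intro hX v hv
    obtain ⟨u, hu, huv⟩ := h ▸ Set.mem_image_of_mem (restrict n) hv
    exact (congrFun huv ⟨k, hk⟩).symm.trans (hX u hu)
  | bot =>
    intro _ X X' h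
    simp only [PTSat]
    rintro rfl
    simpa using h.symm
  | top => simp [PTSat]
  | neg φ ih =>
    intro hφ X X' h
    simp only [PTSat, VarsBelow] at hφ ⊢
    exact forall_mem_not_ptSat_of_image_restrict_eq (ih hφ) h
  | conj φ ψ ihφ ihψ =>
    intro hv X X' h
    simp only [PTSat, VarsBelow] at hv ⊢
    exact And.imp (ihφ hv.1 X X' h) (ihψ hv.2 X X' h)
  | disj φ ψ ihφ ihψ =>
    intro hv X X' h
    simp only [PTSat, VarsBelow] at hv ⊢
    exact Or.imp (ihφ hv.1 X X' h) (ihψ hv.2 X X' h)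
  | tensor φ ψ ihφ ihψ =>
    intro hv X X' h
    simp only [PTSat, VarsBelow] at hv ⊢
    rintro ⟨Y, Z, rfl, hY, hZ⟩
    refine ⟨_, _, ?_,
      ihφ hv.1 _ _ (image_restrict_sep h Set.subset_union_left).symm hY,
      ihψ hv.2 _ _ (image_restrict_sep h Set.subset_union_right).symm hZ⟩
    ext v
    constructor
    · intro hvX
      have hmem := h ▸ Set.mem_image_of_mem (restrict n) hvX
      rw [Set.image_union] at hmem
      exact hmem.imp (⟨hvX, ·⟩) (⟨hvX, ·⟩)
    · rintro (hvX | hvX) <;> exact hvX.1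
  | impl φ ψ ihφ ihψ =>
    intro hv X X' h
    simp only [PTSat, VarsBelow] at hv ⊢
    intro hX Y hYX' hY
    have hr := image_restrict_sep h.symm hYX'
    exact ihψ hv.2 _ _ hr (hX _ (Set.sep_subset _ _) (ihφ hv.1 _ _ hr.symm hY))
  | dep l ψ ihl ihψ =>
    intro hv X X' h
    simp only [PTSat, VarsBelow] at hv ⊢
    intro hX Y hYX' hY
    have hr := image_restrict_sep h.symm hYX'
    have transfer {χ : PTForm}
        (hχ : ∀ X X' : Team, restrict n '' X = restrict n '' X' → PTSat X χ → PTSat X' χ)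
        {Y Y' : Team} (hYY' : restrict n '' Y = restrict n '' Y') :
        (PTSat Y χ ∨ ∀ v ∈ Y, ¬ PTSat {v} χ) → (PTSat Y' χ ∨ ∀ v ∈ Y', ¬ PTSat {v} χ) :=
      Or.imp (hχ Y Y' hYY') (forall_mem_not_ptSat_of_image_restrict_eq hχ hYY')
    exact transfer (ihψ hv.2) hr (hX _ (Set.sep_subset _ _)
      fun χ hχ => transfer (ihl χ hχ (hv.1 χ hχ)) hr.symm (hY χ hχ))

section UltraLimit

open Filter

variable {ι : Type*} (U : Ultrafilter ι)

open Classical in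
/-- The pointwise limit of a family of valuations along an ultrafilter. -/
noncomputable def ultraVal (f : ι → Val) : Val := fun p => decide (∀ᶠ i in U, f i p = true)

/-- The limit of a family of teams along an ultrafilter. -/
def ultraTeam (X : ι → Team) : Team :=
  {v | ∃ f : ι → Val, (∀ᶠ i in U, f i ∈ X i) ∧ ultraVal U f = v}

theorem eventually_restrict_eq_ultraVal (n : ℕ) (f : ι → Val) :
    ∀ᶠ i in U, restrict n (f i) = restrict n (ultraVal U f) := by
  simp only [funext_iff, restrict]
  refine eventually_all.2 fun k => ?_
  by_cases hk : ∀ᶠ i in U, f i k = true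
  · filter_upwards [hk] with i hi
    simp [ultraVal, hk, hi]
  · filter_upwards [Ultrafilter.eventually_not.2 hk] with i hi
    simpa [ultraVal, hk] using hi

theorem eventually_image_restrict_eq_ultraTeam (n : ℕ) (X : ι → Team) :
    ∀ᶠ i in U, restrict n '' X i = restrict n '' ultraTeam U X := by
  simp only [Set.ext_iff]
  refine eventually_all.2 fun w => ?_
  by_cases hw : ∀ᶠ i in U, w ∈ restrict n '' X i
  · have hlim : w ∈ restrict n '' ultraTeam U X := by
      obtain ⟨f, hf⟩ := Filter.skolem.1 hw
      obtain ⟨i, hi, hfi⟩ := ((eventually_restrict_eq_ultraVal U n f).and hf).exists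
      exact ⟨_, ⟨f, hf.mono fun _ h => h.1, rfl⟩, hi.symm.trans hfi.2⟩
    exact hw.mono fun i hi => iff_of_true hi hlim
  · have hlim : w ∉ restrict n '' ultraTeam U X := by
      rintro ⟨_, ⟨f, hf, rfl⟩, rfl⟩
      refine hw ?_
      filter_upwards [hf, eventually_restrict_eq_ultraVal U n f] with i hi hfi
      exact ⟨f i, hi, hfi⟩
    exact (Ultrafilter.eventually_not.2 hw).mono fun i hi => iff_of_false hi hlim

theorem ptSat_ultraTeam_iff (X : ι → Team) (φ : PTForm) :
    PTSat (ultraTeam U X) φ ↔ ∀ᶠ i in U, PTSat (X i) φ := by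
  obtain ⟨n, hn⟩ := exists_varsBelow φ
  have hr := eventually_image_restrict_eq_ultraTeam U n X
  constructor
  · intro h
    exact hr.mono fun i hi => PTSat.of_image_restrict_eq φ hn _ _ hi.symm h
  · intro h
    obtain ⟨i, hi, hsat⟩ := (hr.and h).exists
    exact PTSat.of_image_restrict_eq φ hn _ _ hi hsat

end UltraLimit

/-- Compactness Theorem. -/
theorem pt_compactness (Γ : Set PTForm) (φ : PTForm) (h : PTSetConseq Γ φ) :
    ∃ Δ : Finset PTForm, ↑Δ ⊆ Γ ∧ PTSetConseq ↑Δ φ := by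
  by_contra! hcon
  have hex (Δ : Finset Γ) : ∃ X : Team, (∀ ψ ∈ Δ, PTSat X ψ) ∧ ¬ PTSat X φ := by
    have hΔ := hcon (Δ.map (Function.Embedding.subtype _)) (by
      intro ψ hψ
      obtain ⟨χ, -, rfl⟩ := Finset.mem_map.1 hψ
      exact χ.2)
    simp only [PTSetConseq, not_forall] at hΔ
    obtain ⟨X, hX, hXφ⟩ := hΔ
    exact ⟨X, fun ψ hψ => hX ψ (Finset.mem_map_of_mem _ hψ), hXφ⟩
  choose X hXΔ hXφ using hex
  let U : Ultrafilter (Finset Γ) := Ultrafilter.of Filter.atTop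
  have hsat : PTSat (ultraTeam U X) φ := h _ fun ψ hψ => by
    refine (ptSat_ultraTeam_iff U X ψ).2 (Ultrafilter.of_le Filter.atTop ?_)
    filter_upwards [Filter.eventually_ge_atTop {⟨ψ, hψ⟩}] with Δ hΔ
    exact hXΔ Δ ⟨ψ, hψ⟩ (Finset.singleton_subset_iff.1 hΔ)
  obtain ⟨Δ, hΔ⟩ := ((ptSat_ultraTeam_iff U X φ).1 hsat).exists
  exact hXφ Δ hΔ
end

section
/- (Disjunction property) Let φ be a formula of propositional team logic and {φᵢ : i∈I} a finite family of formulas such that (a) φᵢ ⊨ φ for every i∈I, and (b) for every team X, if X ⊨ φ then X ⊨ φᵢ for some i∈I. If φ is valid (⊨ φ), then ⊨ φᵢ for some i∈I. -/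
/-- Team satisfaction is downward closed. -/
theorem PTSat.mono {X Y : Team} {φ : PTForm} (hYX : Y ⊆ X) (h : PTSat X φ) : PTSat Y φ := by
  match φ with
  | .var n =>
    rw [PTSat] at h ⊢
    exact fun v hv => h v (hYX hv)
  | .bot =>
    rw [PTSat] at h ⊢
    exact Set.subset_eq_empty hYX h
  | .top =>
    rw [PTSat]
    trivial
  | .neg φ =>
    rw [PTSat] at h ⊢
    exact fun v hv => h v (hYX hv)
  | .conj φ ψ =>
    rw [PTSat] at h ⊢
    exact ⟨h.1.mono hYX, h.2.mono hYX⟩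
  | .tensor φ ψ =>
    rw [PTSat] at h ⊢
    obtain ⟨A, B, rfl, hA, hB⟩ := h
    refine ⟨Y ∩ A, Y ∩ B, ?_, hA.mono Set.inter_subset_right, hB.mono Set.inter_subset_right⟩
    rw [← Set.inter_union_distrib_left, Set.inter_eq_left.mpr hYX]
  | .disj φ ψ =>
    rw [PTSat] at h ⊢
    exact h.imp (fun h => h.mono hYX) (fun h => h.mono hYX)
  | .impl φ ψ =>
    rw [PTSat] at h ⊢
    exact fun Z hZ => h Z (hZ.trans hYX)
  | .dep l ψ =>
    rw [PTSat] at h ⊢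
    exact fun Z hZ => h Z (hZ.trans hYX)

/-- A formula is valid as soon as the team of all valuations satisfies it. -/
theorem PTValid.of_univ {φ : PTForm} (h : PTSat Set.univ φ) : PTValid φ :=
  fun X => h.mono (Set.subset_univ X)

/-- Disjunction property. -/
theorem pt_disjunction_property {I : Type} [Finite I] (φ : PTForm) (f : I → PTForm)
    (h1 : ∀ i : I, PTConseq (f i) φ)
    (h2 : ∀ X : Team, PTSat X φ → ∃ i : I, PTSat X (f i))
    (hv : PTValid φ) :
    ∃ i : I, PTValid (f i) :=
  (h2 Set.univ (hv Set.univ)).imp fun _ => PTValid.of_univ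
end

section
/- For any finite set V = {p₁,…,pₙ} of propositional variables and any teams X and Y on V: Y ⊨ Θ_X if and only if Y ⊆ X, where Θ_X := ¬¬⋁_{v∈X}(p₁^{v(p₁)}∧…∧pₙ^{v(pₙ)}) for nonempty X and Θ_∅ := ⊥. -/
/-- A nonempty team satisfies a finite intuitionistic disjunction iff it satisfies a disjunct. -/
theorem ptSat_bigDisj {X : Team} (hX : X ≠ ∅) (l : List PTForm) :
    PTSat X (bigDisj l) ↔ ∃ φ ∈ l, PTSat X φ := by
  induction l with
  | nil => simp [bigDisj, PTSat, hX]
  | cons φ l ih =>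
    have h : bigDisj (φ :: l) = .disj φ (bigDisj l) := rfl
    simp [h, PTSat, ih]

/-- A single valuation satisfies `literal n v` iff its restriction is `v`. -/
theorem ptSat_singleton_literal (n : ℕ) (v : Fin n → Bool) (w : Val) :
    PTSat {w} (literal n v) ↔ restrict n w = v := by
  have key (l : List (Fin n)) :
      PTSat {w} (l.foldr (fun i acc =>
        .conj (if v i then .var i.val else .neg (.var i.val)) acc) .top) ↔
        ∀ i ∈ l, w i.val = v i := by
    induction l with
    | nil => simp [PTSat]
    | cons i l ih =>
      rw [List.foldr_cons, PTSat, ih, List.forall_mem_cons]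
      cases hv : v i <;> simp [PTSat]
  rw [literal, key, funext_iff]
  simp [restrict]

/-- Every assignment to `p_0, …, p_{n-1}` is the restriction of a valuation. -/
theorem restrict_surjective (n : ℕ) : Function.Surjective (restrict n) := fun v =>
  ⟨fun k => if h : k < n then v ⟨k, h⟩ else false, by ext i; simp [restrict]⟩

/-- A team satisfies `Θ_X` iff all its restrictions to `p_0, …, p_{n-1}` lie in `X`. -/
theorem ptSat_theta (n : ℕ) (X : Set (Fin n → Bool)) (T : Team) :
    PTSat T (Theta n X) ↔ ∀ w ∈ T, restrict n w ∈ X := by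
  by_cases hX : X = ∅
  · simp [Theta, hX, PTSat, Set.eq_empty_iff_forall_notMem]
  · simp [Theta, hX, PTSat, ptSat_bigDisj, ptSat_singleton_literal]

/-- `Θ_X` defines the team `X` modulo subteams. -/
theorem pt_theta_defines (n : ℕ) (X Y : Set (Fin n → Bool)) :
    PTSat (liftTeam n Y) (Theta n X) ↔ Y ⊆ X := by
  rw [ptSat_theta]
  exact ((restrict_surjective n).forall (p := fun v => v ∈ Y → v ∈ X)).symm
end

section
/- For every finite set V = {p₁,…,pₙ} of propositional variables and every team X on V, the two normal-form formulas are semantically equivalent: ¬¬⋁_{v∈X}(p₁^{v(p₁)}∧…∧pₙ^{v(pₙ)}) ≡ ⨂_{v∈X}(p₁^{v(p₁)}∧…∧pₙ^{v(pₙ)}). -/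
theorem flat_var (m : ℕ) : Flat (.var m) := fun X => by simp [PTSat]

theorem flat_top : Flat .top := fun X => by simp [PTSat]

theorem flat_neg (φ : PTForm) : Flat (.neg φ) := fun X => by simp [PTSat]

theorem Flat.conj {φ ψ : PTForm} (hφ : Flat φ) (hψ : Flat ψ) : Flat (.conj φ ψ) := fun X => by
  simp only [PTSat]
  rw [hφ X, hψ X]
  exact ⟨fun h v hv => ⟨h.1 v hv, h.2 v hv⟩,
    fun h => ⟨fun v hv => (h v hv).1, fun v hv => (h v hv).2⟩⟩

theorem flat_literal (n : ℕ) (v : Fin n → Bool) : Flat (literal n v) := by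
  unfold literal
  induction List.finRange n with
  | nil => exact flat_top
  | cons i l ih =>
    refine Flat.conj ?_ ih
    split
    · exact flat_var _
    · exact flat_neg _

theorem sat_singleton_bigDisj (v : Val) (l : List PTForm) :
    PTSat {v} (bigDisj l) ↔ ∃ φ ∈ l, PTSat {v} φ := by
  induction l with
  | nil => simp [bigDisj, PTSat]
  | cons φ l ih =>
    have h : PTSat {v} (bigDisj (φ :: l)) ↔ PTSat {v} φ ∨ PTSat {v} (bigDisj l) := by
      simp [bigDisj, PTSat]
    rw [h, ih]
    simp

theorem sat_tensor_iff {φ ψ : PTForm} {P Q : Val → Prop}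
    (hφ : ∀ X, PTSat X φ ↔ ∀ v ∈ X, P v) (hψ : ∀ X, PTSat X ψ ↔ ∀ v ∈ X, Q v) (X : Team) :
    PTSat X (.tensor φ ψ) ↔ ∀ v ∈ X, P v ∨ Q v := by
  simp only [PTSat, hφ, hψ]
  constructor
  · rintro ⟨Y, Z, rfl, hY, hZ⟩ v (hv | hv)
    · exact .inl (hY v hv)
    · exact .inr (hZ v hv)
  · intro h
    refine ⟨{v ∈ X | P v}, {v ∈ X | Q v}, ?_, fun v hv => hv.2, fun v hv => hv.2⟩
    ext v
    have := h v
    simp only [Set.mem_union, Set.mem_ofPred_eq]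
    tauto

theorem sat_bigTensor_iff {l : List PTForm} (hl : ∀ φ ∈ l, Flat φ) (X : Team) :
    PTSat X (bigTensor l) ↔ ∀ v ∈ X, ∃ φ ∈ l, PTSat {v} φ := by
  induction l generalizing X with
  | nil => simp [bigTensor, PTSat, Set.eq_empty_iff_forall_notMem]
  | cons φ l ih =>
    simp only [List.mem_cons, exists_eq_or_imp]
    exact sat_tensor_iff (hl φ List.mem_cons_self)
      (ih fun ψ hψ => hl ψ (List.mem_cons_of_mem φ hψ)) X

theorem sat_neg_neg (X : Team) (φ : PTForm) :
    PTSat X (.neg (.neg φ)) ↔ ∀ v ∈ X, PTSat {v} φ := by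
  simp [PTSat]

/-- The two normal-form formulas are semantically equivalent. -/
theorem pt_theta_forms_equiv (n : ℕ) (X : Set (Fin n → Bool)) :
    PTEquiv (.neg (.neg (bigDisj (X.toFinite.toFinset.toList.map (literal n)))))
      (ThetaTensor n X) := by
  intro Y
  have hl : ∀ φ ∈ X.toFinite.toFinset.toList.map (literal n), Flat φ := by
    intro φ hφ
    obtain ⟨v, -, rfl⟩ := List.mem_map.1 hφ
    exact flat_literal n v
  rw [sat_neg_neg, ThetaTensor, sat_bigTensor_iff hl]
  simp only [sat_singleton_bigDisj]
end

section
/- For every formula φ of propositional dependence logic (PD), the negation ¬φ is semantically equivalent to the syntactic negation φ~ obtained by the De Morgan rewrite rules: ¬φ ≡ φ~, where p~ = ¬p, (¬p)~ = p, ⊤~ = ⊥, ⊥~ = ⊤, (=(p₁,…,pₙ,q))~ = ⊥, (φ∧ψ)~ = φ~⊗ψ~, and (φ⊗ψ)~ = φ~∧ψ~. -/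
theorem ptSat_empty_toPT (φ : PDForm) : PTSat ∅ φ.toPT := by
  induction φ with
  | pos n => simp [PDForm.toPT, PTSat]
  | negv n => simp [PDForm.toPT, PTSat]
  | bot => simp [PDForm.toPT, PTSat]
  | top => simp [PDForm.toPT, PTSat]
  | dep l q =>
    simp only [PDForm.toPT, PTSat]
    intro Y hY _
    exact Or.inl fun v hv => (hY hv).elim
  | conj φ ψ hφ hψ =>
    simp only [PDForm.toPT, PTSat]
    exact ⟨hφ, hψ⟩
  | tensor φ ψ hφ hψ =>
    simp only [PDForm.toPT, PTSat]
    exact ⟨∅, ∅, by simp, hφ, hψ⟩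

theorem ptSat_singleton_dep (v : Val) (l : List PTForm) (n : ℕ) :
    PTSat {v} (.dep l (.var n)) := by
  simp only [PTSat]
  intro Y hY _
  by_cases h : v n = true
  · exact Or.inl fun w hw => by rw [hY hw]; exact h
  · refine Or.inr fun w hw hs => h ?_
    rw [← hY hw]
    exact hs w rfl

theorem ptSat_singleton_tensor_toPT (v : Val) (φ ψ : PDForm) :
    PTSat {v} (.tensor φ.toPT ψ.toPT) ↔ PTSat {v} φ.toPT ∨ PTSat {v} ψ.toPT := by
  simp only [PTSat]
  constructor
  · rintro ⟨Y, Z, hYZ, hY, hZ⟩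
    have hv : v ∈ Y ∪ Z := hYZ ▸ rfl
    have hsub : Y ∪ Z ⊆ {v} := hYZ.ge
    rcases hv with hv | hv
    · left
      rwa [← (Set.subset_union_left.trans hsub).antisymm (Set.singleton_subset_iff.2 hv)]
    · right
      rwa [← (Set.subset_union_right.trans hsub).antisymm (Set.singleton_subset_iff.2 hv)]
  · rintro (h | h)
    · exact ⟨{v}, ∅, by simp, h, ptSat_empty_toPT ψ⟩
    · exact ⟨∅, {v}, by simp, ptSat_empty_toPT φ, h⟩

/-- Semantic negation of PD formulas equals syntactic negation. -/
theorem pd_neg_eq_synNeg (φ : PDForm) :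
    PTEquiv (.neg φ.toPT) φ.synNeg.toPT := by
  induction φ with
  | pos n => exact fun X => Iff.rfl
  | negv n => intro X; simp [PDForm.toPT, PDForm.synNeg, PTSat]
  | bot => intro X; simp [PDForm.toPT, PDForm.synNeg, PTSat]
  | top =>
    intro X
    simp [PDForm.toPT, PDForm.synNeg, PTSat, Set.eq_empty_iff_forall_notMem]
  | dep l q =>
    intro X
    simp only [PDForm.toPT, PDForm.synNeg, PTSat.eq_def X, Set.eq_empty_iff_forall_notMem]
    exact forall₂_congr fun v _ => iff_of_false (not_not.2 (ptSat_singleton_dep v _ q)) id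
  | conj φ ψ hφ hψ =>
    intro X
    simp only [PDForm.toPT, PDForm.synNeg, PTSat, ← hφ _, ← hψ _]
    constructor
    · intro h
      refine ⟨{v ∈ X | ¬ PTSat {v} φ.toPT}, {v ∈ X | ¬ PTSat {v} ψ.toPT}, ?_,
        fun v hv => hv.2, fun v hv => hv.2⟩
      ext v
      have := h v
      simp only [Set.mem_union, Set.mem_ofPred_eq]
      tauto
    · rintro ⟨Y, Z, rfl, hY, hZ⟩ v (hv | hv) ⟨h₁, h₂⟩
      · exact hY v hv h₁
      · exact hZ v hv h₂
  | tensor φ ψ hφ hψ =>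
    intro X
    have h : PTSat X (PDForm.conj φ.synNeg ψ.synNeg).toPT ↔
        PTSat X (.neg φ.toPT) ∧ PTSat X (.neg ψ.toPT) := by
      rw [hφ, hψ, PDForm.toPT, PTSat]
    rw [PDForm.synNeg, h, PDForm.toPT, PTSat, PTSat, PTSat]
    simp only [ptSat_singleton_tensor_toPT, not_or, forall_and]
end

section
/- For every formula φ of propositional team logic, every flat substitution σ, and every team X: X ⊨ σ(φ) if and only if X_σ ⊨ φ, where X_σ = {v_σ : v∈X} and v_σ is the valuation with v_σ(p)=1 iff {v} ⊨ σ(p). -/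
theorem teamSub_singleton (σ : Subst) (v : Val) : teamSub σ {v} = {valSub σ v} :=
  Set.image_singleton

/-- The subteams of `teamSub σ X` are exactly the translations of subteams of `X`. -/
theorem forall_subset_teamSub_iff (σ : Subst) (X : Team) (P : Team → Prop) :
    (∀ Y ⊆ teamSub σ X, P Y) ↔ ∀ Y ⊆ X, P (teamSub σ Y) :=
  Set.forall_subset_image_iff

/-- The translation of teams commutes with splitting a team into two subteams. -/
theorem exists_teamSub_eq_union_iff (σ : Subst) (X : Team) (P Q : Team → Prop) :
    (∃ Y Z, teamSub σ X = Y ∪ Z ∧ P Y ∧ Q Z) ↔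
      ∃ Y Z, X = Y ∪ Z ∧ P (teamSub σ Y) ∧ Q (teamSub σ Z) := by
  constructor
  · rintro ⟨Y, Z, h, hY, hZ⟩
    have key : ∀ W ⊆ teamSub σ X, teamSub σ (X ∩ valSub σ ⁻¹' W) = W := fun W hW => by
      rw [teamSub, Set.image_inter_preimage]
      exact Set.inter_eq_right.mpr hW
    refine ⟨X ∩ valSub σ ⁻¹' Y, X ∩ valSub σ ⁻¹' Z, ?_, ?_, ?_⟩
    · rw [← Set.inter_union_distrib_left, ← Set.preimage_union, ← h]
      exact (Set.inter_eq_left.mpr (Set.subset_preimage_image _ _)).symm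
    · rwa [key Y (h ▸ Set.subset_union_left)]
    · rwa [key Z (h ▸ Set.subset_union_right)]
  · rintro ⟨Y, Z, rfl, hY, hZ⟩
    exact ⟨_, _, Set.image_union _ _ _, hY, hZ⟩

theorem forall_not_sat_singleton_iff {σ : Subst} {φ : PTForm}
    (h : ∀ X : Team, PTSat X (applySubst σ φ) ↔ PTSat (teamSub σ X) φ) (X : Team) :
    (∀ v ∈ X, ¬ PTSat {v} (applySubst σ φ)) ↔ ∀ v ∈ teamSub σ X, ¬ PTSat {v} φ := by
  simp only [h, teamSub_singleton]
  exact (Set.forall_mem_image (f := valSub σ) (p := fun w => ¬ PTSat {w} φ)).symm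

/-- Flat substitutions and the induced team translation. -/
theorem pt_flat_subst_translation (φ : PTForm) (σ : Subst) (hσ : FlatSubst σ)
    (X : Team) :
    PTSat X (applySubst σ φ) ↔ PTSat (teamSub σ X) φ := by
  induction φ using PTForm.rec
    (motive_2 := fun l => ∀ φ ∈ l, ∀ X : Team,
      PTSat X (applySubst σ φ) ↔ PTSat (teamSub σ X) φ) generalizing X with
  | var n =>
    rw [applySubst, hσ n X]
    simp [PTSat, teamSub, valSub]
  | bot => simp [applySubst, PTSat, teamSub]
  | top => simp [applySubst, PTSat]
  | neg φ ih =>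
    simp only [applySubst, PTSat]
    exact forall_not_sat_singleton_iff ih X
  | conj φ ψ ihφ ihψ => simp only [applySubst, PTSat, ihφ, ihψ]
  | disj φ ψ ihφ ihψ => simp only [applySubst, PTSat, ihφ, ihψ]
  | tensor φ ψ ihφ ihψ =>
    simp only [applySubst, PTSat, ihφ, ihψ, exists_teamSub_eq_union_iff]
  | impl φ ψ ihφ ihψ =>
    simp only [applySubst, PTSat, ihφ, ihψ, forall_subset_teamSub_iff]
  | dep l ψ ihl ihψ =>
    simp only [applySubst, PTSat, forall_subset_teamSub_iff, List.forall_mem_map,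
      List.mem_attach, forall_const, Subtype.forall, forall_not_sat_singleton_iff ihψ]
    refine forall₂_congr fun Y _ => ?_
    rw [ihψ]
    refine imp_congr_left (forall₂_congr fun φ hφ => ?_)
    rw [forall_not_sat_singleton_iff (ihl φ hφ), ihl φ hφ]
  | nil φ hφ => exact absurd hφ List.not_mem_nil
  | cons φ l ihφ ihl ψ hψ =>
    exact List.forall_mem_cons.mpr ⟨ihφ, ihl⟩ ψ hψ _
end

section
/- The set of flat formulas of propositional team logic is closed under flat substitutions: if φ is a flat formula and σ is a flat substitution, then σ(φ) is flat. -/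
/-- A flat substitution acts on formulas as its induced map acts on teams. -/
theorem ptSat_applySubst {σ : Subst} (hσ : FlatSubst σ) (φ : PTForm) (X : Team) :
    PTSat X (applySubst σ φ) ↔ PTSat (teamSub σ X) φ := by
  match φ with
  | .var n =>
    rw [applySubst, hσ n X]
    simp [PTSat, teamSub, valSub]
  | .bot => simp [applySubst, PTSat, teamSub]
  | .top => simp [applySubst, PTSat]
  | .neg φ =>
    simp [applySubst, PTSat, ptSat_applySubst hσ φ, teamSub]
  | .conj φ ψ =>
    simp [applySubst, PTSat, ptSat_applySubst hσ φ, ptSat_applySubst hσ ψ]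
  | .disj φ ψ =>
    simp [applySubst, PTSat, ptSat_applySubst hσ φ, ptSat_applySubst hσ ψ]
  | .impl φ ψ =>
    simp [applySubst, PTSat, ptSat_applySubst hσ φ, ptSat_applySubst hσ ψ, teamSub,
      Set.forall_subset_image_iff]
  | .tensor φ ψ =>
    simp only [applySubst, PTSat, ptSat_applySubst hσ φ, ptSat_applySubst hσ ψ, teamSub]
    constructor
    · rintro ⟨Y, Z, rfl, hY, hZ⟩
      exact ⟨_, _, Set.image_union _ _ _, hY, hZ⟩
    · rintro ⟨Y, Z, h, hY, hZ⟩
      refine ⟨X ∩ valSub σ ⁻¹' Y, X ∩ valSub σ ⁻¹' Z, ?_, ?_, ?_⟩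
      · rw [← Set.inter_union_distrib_left, ← Set.preimage_union, ← h, eq_comm,
          Set.inter_eq_left]
        exact Set.subset_preimage_image _ _
      · rwa [Set.image_inter_preimage, h, Set.union_inter_cancel_left]
      · rwa [Set.image_inter_preimage, h, Set.union_inter_cancel_right]
  | .dep l ψ =>
    have hl : ∀ χ ∈ l, ∀ Y : Team, PTSat Y (applySubst σ χ) ↔ PTSat (teamSub σ Y) χ :=
      fun χ _ => ptSat_applySubst hσ χ
    simp only [applySubst, PTSat, ptSat_applySubst hσ ψ, teamSub,
      Set.forall_subset_image_iff, Set.forall_mem_image, Set.image_singleton,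
      List.attach_map_val (l := l) (f := applySubst σ), List.forall_mem_map] at hl ⊢
    refine forall₂_congr fun Y _ => imp_congr_left (forall₂_congr fun χ hχ => ?_)
    simp only [hl χ hχ, Set.image_singleton]
termination_by sizeOf φ
decreasing_by
  all_goals simp_wf
  all_goals first
    | omega
    | (have := List.sizeOf_lt_of_mem ‹_ ∈ _›; omega)

/-- Flat formulas are closed under flat substitutions. -/
theorem pt_flat_closed_under_flat_subst (φ : PTForm) (hφ : Flat φ)
    (σ : Subst) (hσ : FlatSubst σ) :
    Flat (applySubst σ φ) := by
  intro X
  simp only [ptSat_applySubst hσ, hφ (teamSub σ X)]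
  simp [teamSub]
end

section
/- For every nonempty team X on a finite set {p₁,…,pₙ} of propositional variables, the formula Θ_X := ¬¬⋁_{v∈X}(p₁^{v(p₁)}∧…∧pₙ^{v(pₙ)}) is F-projective: there is a flat substitution σ such that ⊨ σ(Θ_X), and for every variable p both {Θ_X, σ(p)} ⊨ p and {Θ_X, p} ⊨ σ(p). Moreover, σ can be taken as Prucnal's substitution determined by any v∈X: σ(p) = Θ_X ∧ p if v(p)=0 and σ(p) = Θ_X → p if v(p)=1. -/
theorem PTSat_singleton_literal (n : ℕ) (u : Fin n → Bool) (w : Val) :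
    PTSat {w} (literal n u) ↔ restrict n w = u := by
  have fold (l : List (Fin n)) :
      PTSat {w} (l.foldr (fun i acc =>
        .conj (if u i then .var i.val else .neg (.var i.val)) acc) .top) ↔
      ∀ i ∈ l, w i = u i := by
    induction l with
    | nil => simp [PTSat]
    | cons i l ih =>
      rw [List.foldr_cons, PTSat, ih, List.forall_mem_cons]
      cases h : u i <;> simp [PTSat]
  rw [literal, fold]
  simp [funext_iff, restrict]

theorem PTSat_singleton_applySubst_literal (σ : Subst) (n : ℕ) (u : Fin n → Bool) (w : Val) :
    PTSat {w} (applySubst σ (literal n u)) ↔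
      ∀ i : Fin n, PTSat {w} (σ i) ↔ u i = true := by
  have fold (l : List (Fin n)) :
      PTSat {w} (applySubst σ (l.foldr (fun i acc =>
        .conj (if u i then .var i.val else .neg (.var i.val)) acc) .top)) ↔
      ∀ i ∈ l, (PTSat {w} (σ i) ↔ u i = true) := by
    induction l with
    | nil => simp [PTSat, applySubst]
    | cons i l ih =>
      rw [List.foldr_cons, applySubst, PTSat, ih, List.forall_mem_cons]
      cases h : u i <;> simp [PTSat, applySubst]
  rw [literal, fold]
  simp

theorem PTSat_singleton_bigDisj (w : Val) (l : List PTForm) :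
    PTSat {w} (bigDisj l) ↔ ∃ φ ∈ l, PTSat {w} φ := by
  induction l with
  | nil => simp [bigDisj, PTSat]
  | cons φ l ih =>
    rw [bigDisj, List.foldr_cons, PTSat, ← bigDisj, ih]
    simp

theorem applySubst_bigDisj (σ : Subst) (l : List PTForm) :
    applySubst σ (bigDisj l) = bigDisj (l.map (applySubst σ)) := by
  induction l with
  | nil => simp [bigDisj, applySubst]
  | cons φ l ih =>
    rw [bigDisj, List.foldr_cons, applySubst, ← bigDisj, ih]
    simp [bigDisj]

theorem PTSat_neg_neg (Z : Team) (φ : PTForm) :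
    PTSat Z (.neg (.neg φ)) ↔ ∀ w ∈ Z, PTSat {w} φ := by
  simp [PTSat]

theorem PTSat_Theta {n : ℕ} {X : Set (Fin n → Bool)} (hX : X.Nonempty) (Z : Team) :
    PTSat Z (Theta n X) ↔ ∀ w ∈ Z, restrict n w ∈ X := by
  rw [Theta, if_neg hX.ne_empty, PTSat_neg_neg]
  simp [PTSat_singleton_bigDisj, PTSat_singleton_literal]

theorem PTSat_applySubst_Theta {n : ℕ} {X : Set (Fin n → Bool)} (hX : X.Nonempty)
    (σ : Subst) (Z : Team) :
    PTSat Z (applySubst σ (Theta n X)) ↔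
      ∀ w ∈ Z, ∃ u ∈ X, ∀ i : Fin n, PTSat {w} (σ i) ↔ u i = true := by
  rw [Theta, if_neg hX.ne_empty, applySubst, applySubst, PTSat_neg_neg, applySubst_bigDisj]
  simp [PTSat_singleton_bigDisj, PTSat_singleton_applySubst_literal]

theorem PTSat_prucnal_Theta {n : ℕ} {X : Set (Fin n → Bool)} (hX : X.Nonempty)
    (v : Fin n → Bool) (p : ℕ) (Z : Team) :
    PTSat Z (prucnal (Theta n X) n v p) ↔ ∀ w ∈ Z,
      if h : p < n then
        (if v ⟨p, h⟩ then restrict n w ∈ X → w p = true else restrict n w ∈ X ∧ w p = true)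
      else w p = true := by
  unfold prucnal
  split_ifs with h hv
  · simp only [PTSat, PTSat_Theta hX]
    refine ⟨fun H w hw hwX => ?_, fun H Y hY hYX w hw => H w (hY hw) (hYX w hw)⟩
    exact H {w} (by simpa using hw) (by simpa using hwX) w rfl
  · simp only [PTSat, PTSat_Theta hX, forall_and]
  · simp only [PTSat]

theorem flatSubst_prucnal_Theta {n : ℕ} {X : Set (Fin n → Bool)} (hX : X.Nonempty)
    (v : Fin n → Bool) : FlatSubst (prucnal (Theta n X) n v) := by
  intro p Z
  simp only [PTSat_prucnal_Theta hX, Set.mem_singleton_iff, forall_eq]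

theorem ptValid_applySubst_prucnal_Theta {n : ℕ} {X : Set (Fin n → Bool)}
    {v : Fin n → Bool} (hv : v ∈ X) :
    PTValid (applySubst (prucnal (Theta n X) n v) (Theta n X)) := by
  have hX : X.Nonempty := ⟨v, hv⟩
  intro Z
  rw [PTSat_applySubst_Theta hX]
  intro w _
  by_cases hw : restrict n w ∈ X
  · refine ⟨restrict n w, hw, fun i => ?_⟩
    simp [PTSat_prucnal_Theta hX, hw, restrict]
  · refine ⟨v, hv, fun i => ?_⟩
    simp [PTSat_prucnal_Theta hX, hw]

theorem PTSat_prucnal_Theta_iff_var {n : ℕ} {X : Set (Fin n → Bool)} (hX : X.Nonempty)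
    (v : Fin n → Bool) (p : ℕ) {Z : Team} (hZ : PTSat Z (Theta n X)) :
    PTSat Z (prucnal (Theta n X) n v p) ↔ PTSat Z (.var p) := by
  rw [PTSat_Theta hX] at hZ
  rw [PTSat_prucnal_Theta hX, PTSat]
  refine forall₂_congr fun w hw => ?_
  simp [hZ w hw]

/-- `Θ_X` is F-projective, via Prucnal's substitution. -/
theorem pt_theta_projective (n : ℕ) (X : Set (Fin n → Bool)) (hX : X.Nonempty) :
    FProjective (Theta n X) ∧
    ∀ v ∈ X,
      FlatSubst (prucnal (Theta n X) n v) ∧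
      PTValid (applySubst (prucnal (Theta n X) n v) (Theta n X)) ∧
      ∀ p : ℕ,
        (∀ Z : Team, PTSat Z (Theta n X) →
          PTSat Z (prucnal (Theta n X) n v p) → PTSat Z (.var p)) ∧
        (∀ Z : Team, PTSat Z (Theta n X) →
          PTSat Z (.var p) → PTSat Z (prucnal (Theta n X) n v p)) := by
  have prucnal_spec : ∀ v ∈ X,
      FlatSubst (prucnal (Theta n X) n v) ∧
      PTValid (applySubst (prucnal (Theta n X) n v) (Theta n X)) ∧
      ∀ p : ℕ,
        (∀ Z : Team, PTSat Z (Theta n X) →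
          PTSat Z (prucnal (Theta n X) n v p) → PTSat Z (.var p)) ∧
        (∀ Z : Team, PTSat Z (Theta n X) →
          PTSat Z (.var p) → PTSat Z (prucnal (Theta n X) n v p)) :=
    fun v hv => ⟨flatSubst_prucnal_Theta hX v, ptValid_applySubst_prucnal_Theta hv, fun p =>
      ⟨fun _ hZ => (PTSat_prucnal_Theta_iff_var hX v p hZ).1,
        fun _ hZ => (PTSat_prucnal_Theta_iff_var hX v p hZ).2⟩⟩
  obtain ⟨v, hv⟩ := hX
  exact ⟨⟨_, prucnal_spec v hv⟩, prucnal_spec⟩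
end

section
/- For every nonempty team X on a finite set {p₁,…,pₙ} of propositional variables, the tensor normal-form formula Θ⊗_X := ⨂_{v∈X}(p₁^{v(p₁)}∧…∧pₙ^{v(pₙ)}) is F-projective: there is a flat substitution σ such that ⊨ σ(Θ⊗_X), and for every variable p both {Θ⊗_X, σ(p)} ⊨ p and {Θ⊗_X, p} ⊨ σ(p). Moreover, σ can be taken as the substitution determined by any v∈X: σ(p) = Θ⊗_X ∧ p if v(p)=0 and σ(p) = ¬Θ⊗_X ⊗ p if v(p)=1. -/
/-- On classical formulas team satisfaction is pointwise truth-table satisfaction. -/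
theorem ptSat_iff_forall_cSat : ∀ (φ : PTForm), IsClassical φ →
    ∀ X : Team, PTSat X φ ↔ ∀ v ∈ X, CSat v φ
  | .var _, _, X => by simp [PTSat, CSat]
  | .bot, _, X => by simp [PTSat, CSat, Set.eq_empty_iff_forall_notMem]
  | .top, _, X => by simp [PTSat, CSat]
  | .neg φ, h, X => by
      simp [PTSat, CSat, ptSat_iff_forall_cSat φ h]
  | .conj φ ψ, h, X => by
      simp only [PTSat, CSat, ptSat_iff_forall_cSat φ h.1, ptSat_iff_forall_cSat ψ h.2]
      exact ⟨fun H v hv => ⟨H.1 v hv, H.2 v hv⟩,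
        fun H => ⟨fun v hv => (H v hv).1, fun v hv => (H v hv).2⟩⟩
  | .tensor φ ψ, h, X => by
      simp only [PTSat, CSat, ptSat_iff_forall_cSat φ h.1, ptSat_iff_forall_cSat ψ h.2]
      constructor
      · rintro ⟨Y, Z, rfl, hY, hZ⟩ v (hv | hv)
        · exact Or.inl (hY v hv)
        · exact Or.inr (hZ v hv)
      · intro H
        refine ⟨{v ∈ X | CSat v φ}, {v ∈ X | CSat v ψ}, ?_, fun v hv => hv.2, fun v hv => hv.2⟩
        ext v
        constructor
        · intro hv
          exact (H v hv).imp (fun k => ⟨hv, k⟩) (fun k => ⟨hv, k⟩)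
        · rintro (hv | hv) <;> exact hv.1
  | .disj _ _, h, _ => h.elim
  | .impl φ ψ, h, X => by
      simp only [PTSat, CSat, ptSat_iff_forall_cSat φ h.1, ptSat_iff_forall_cSat ψ h.2]
      constructor
      · intro H v hv hφ
        exact H {v} (by simpa using hv) (by simpa using hφ) v rfl
      · intro H Y hY hφ v hv
        exact H v (hY hv) (hφ v hv)
  | .dep _ _, h, _ => h.elim

theorem IsClassical.flat {φ : PTForm} (h : IsClassical φ) : Flat φ := by
  intro X
  simp [ptSat_iff_forall_cSat φ h]

theorem IsClassical.applySubst {σ : Subst} (hσ : ∀ p, IsClassical (σ p)) :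
    ∀ φ : PTForm, IsClassical φ → IsClassical (applySubst σ φ)
  | .var p, _ => by simpa [_root_.applySubst] using hσ p
  | .bot, _ => by simp [_root_.applySubst, IsClassical]
  | .top, _ => by simp [_root_.applySubst, IsClassical]
  | .neg φ, h => by
      simpa [_root_.applySubst, IsClassical] using IsClassical.applySubst hσ φ h
  | .conj φ ψ, h => by
      simpa [_root_.applySubst, IsClassical] using
        ⟨IsClassical.applySubst hσ φ h.1, IsClassical.applySubst hσ ψ h.2⟩
  | .tensor φ ψ, h => by
      simpa [_root_.applySubst, IsClassical] using
        ⟨IsClassical.applySubst hσ φ h.1, IsClassical.applySubst hσ ψ h.2⟩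
  | .disj _ _, h => h.elim
  | .impl φ ψ, h => by
      simpa [_root_.applySubst, IsClassical] using
        ⟨IsClassical.applySubst hσ φ h.1, IsClassical.applySubst hσ ψ h.2⟩
  | .dep _ _, h => h.elim

/-- The substitution lemma for truth-table satisfaction of classical formulas. -/
theorem cSat_applySubst {σ : Subst} {w u : Val} (hu : ∀ p, u p = true ↔ CSat w (σ p)) :
    ∀ φ : PTForm, IsClassical φ → (CSat w (applySubst σ φ) ↔ CSat u φ)
  | .var p, _ => by simp [applySubst, CSat, hu]
  | .bot, _ => by simp [applySubst, CSat]
  | .top, _ => by simp [applySubst, CSat]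
  | .neg φ, h => by simp [applySubst, CSat, cSat_applySubst hu φ h]
  | .conj φ ψ, h => by
      simp [applySubst, CSat, cSat_applySubst hu φ h.1, cSat_applySubst hu ψ h.2]
  | .tensor φ ψ, h => by
      simp [applySubst, CSat, cSat_applySubst hu φ h.1, cSat_applySubst hu ψ h.2]
  | .disj _ _, h => h.elim
  | .impl φ ψ, h => by
      simp [applySubst, CSat, cSat_applySubst hu φ h.1, cSat_applySubst hu ψ h.2]
  | .dep _ _, h => h.elim

theorem isClassical_literal (n : ℕ) (v : Fin n → Bool) : IsClassical (literal n v) := by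
  unfold literal
  induction List.finRange n with
  | nil => trivial
  | cons i l ih =>
    refine ⟨?_, ih⟩
    split <;> trivial

theorem cSat_literal (n : ℕ) (v : Fin n → Bool) (w : Val) :
    CSat w (literal n v) ↔ restrict n w = v := by
  have key : ∀ l : List (Fin n), CSat w (l.foldr
      (fun i acc => .conj (if v i then .var i.val else .neg (.var i.val)) acc) .top) ↔
      ∀ i ∈ l, w i.val = v i := by
    intro l
    induction l with
    | nil => simp [CSat]
    | cons i l ih =>
      simp only [List.foldr_cons, CSat, ih, List.forall_mem_cons]
      cases hv : v i <;> simp [CSat]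
  simp [literal, key, funext_iff, restrict]

theorem isClassical_bigTensor {l : List PTForm} (h : ∀ φ ∈ l, IsClassical φ) :
    IsClassical (bigTensor l) := by
  induction l with
  | nil => trivial
  | cons φ l ih =>
    exact ⟨h φ (by simp), ih fun ψ hψ => h ψ (by simp [hψ])⟩

theorem cSat_bigTensor (w : Val) (l : List PTForm) :
    CSat w (bigTensor l) ↔ ∃ φ ∈ l, CSat w φ := by
  unfold bigTensor
  induction l with
  | nil => simp [CSat]
  | cons φ l ih => simp [CSat, ih]

theorem isClassical_thetaTensor (n : ℕ) (X : Set (Fin n → Bool)) :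
    IsClassical (ThetaTensor n X) := by
  refine isClassical_bigTensor fun φ hφ => ?_
  obtain ⟨v, -, rfl⟩ := List.mem_map.1 hφ
  exact isClassical_literal n v

theorem cSat_thetaTensor (n : ℕ) (X : Set (Fin n → Bool)) (w : Val) :
    CSat w (ThetaTensor n X) ↔ restrict n w ∈ X := by
  simp [ThetaTensor, cSat_bigTensor, cSat_literal]

theorem isClassical_prucnalT {θ : PTForm} (hθ : IsClassical θ) (n : ℕ) (v : Fin n → Bool)
    (p : ℕ) : IsClassical (prucnalT θ n v p) := by
  unfold prucnalT
  split_ifs <;> simp [IsClassical, hθ]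

theorem cSat_prucnalT_of_cSat {θ : PTForm} {w : Val} (h : CSat w θ) (n : ℕ)
    (v : Fin n → Bool) (p : ℕ) : CSat w (prucnalT θ n v p) ↔ w p = true := by
  unfold prucnalT
  split_ifs <;> simp [CSat, h]

theorem cSat_prucnalT_of_not_cSat {θ : PTForm} {w : Val} (h : ¬ CSat w θ) (n : ℕ)
    (v : Fin n → Bool) (i : Fin n) : CSat w (prucnalT θ n v i) ↔ v i = true := by
  unfold prucnalT
  cases hv : v i <;> simp [CSat, h, hv]

theorem valid_applySubst_prucnalT_thetaTensor {n : ℕ} {X : Set (Fin n → Bool)}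
    {v : Fin n → Bool} (hv : v ∈ X) :
    PTValid (applySubst (prucnalT (ThetaTensor n X) n v) (ThetaTensor n X)) := by
  classical
  have hθ := isClassical_thetaTensor n X
  intro Z
  rw [ptSat_iff_forall_cSat _ (IsClassical.applySubst (isClassical_prucnalT hθ n v) _ hθ)]
  intro w _
  rw [cSat_applySubst (u := fun p => decide (CSat w (prucnalT (ThetaTensor n X) n v p)))
    (by simp) _ hθ, cSat_thetaTensor]
  by_cases hw : CSat w (ThetaTensor n X)
  · convert (cSat_thetaTensor n X w).1 hw using 1
    funext i
    simp [restrict, cSat_prucnalT_of_cSat hw]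
  · convert hv using 1
    funext i
    simp [restrict, cSat_prucnalT_of_not_cSat hw]

theorem ptSat_prucnalT_iff {θ : PTForm} (hθ : IsClassical θ) (n : ℕ) (v : Fin n → Bool)
    (p : ℕ) {Z : Team} (hZ : PTSat Z θ) :
    PTSat Z (prucnalT θ n v p) ↔ PTSat Z (.var p) := by
  rw [ptSat_iff_forall_cSat _ hθ] at hZ
  rw [ptSat_iff_forall_cSat _ (isClassical_prucnalT hθ n v p),
    ptSat_iff_forall_cSat (.var p) trivial]
  exact forall₂_congr fun w hw => cSat_prucnalT_of_cSat (hZ w hw) n v p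

/-- The tensor normal form `Θ⊗_X` is F-projective. -/
theorem pt_theta_tensor_projective (n : ℕ) (X : Set (Fin n → Bool)) (hX : X.Nonempty) :
    FProjective (ThetaTensor n X) ∧
    ∀ v ∈ X,
      FlatSubst (prucnalT (ThetaTensor n X) n v) ∧
      PTValid (applySubst (prucnalT (ThetaTensor n X) n v) (ThetaTensor n X)) ∧
      ∀ p : ℕ,
        (∀ Z : Team, PTSat Z (ThetaTensor n X) →
          PTSat Z (prucnalT (ThetaTensor n X) n v p) → PTSat Z (.var p)) ∧
        (∀ Z : Team, PTSat Z (ThetaTensor n X) →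
          PTSat Z (.var p) → PTSat Z (prucnalT (ThetaTensor n X) n v p)) := by
  have hθ := isClassical_thetaTensor n X
  have main : ∀ v ∈ X,
      FlatSubst (prucnalT (ThetaTensor n X) n v) ∧
      PTValid (applySubst (prucnalT (ThetaTensor n X) n v) (ThetaTensor n X)) ∧
      ∀ p : ℕ,
        (∀ Z : Team, PTSat Z (ThetaTensor n X) →
          PTSat Z (prucnalT (ThetaTensor n X) n v p) → PTSat Z (.var p)) ∧
        (∀ Z : Team, PTSat Z (ThetaTensor n X) →
          PTSat Z (.var p) → PTSat Z (prucnalT (ThetaTensor n X) n v p)) :=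
    fun v hv => ⟨fun p => (isClassical_prucnalT hθ n v p).flat,
      valid_applySubst_prucnalT_thetaTensor hv,
      fun p => ⟨fun _ hZ => (ptSat_prucnalT_iff hθ n v p hZ).1,
        fun _ hZ => (ptSat_prucnalT_iff hθ n v p hZ).2⟩⟩
  obtain ⟨v, hv⟩ := hX
  exact ⟨⟨_, main v hv⟩, main⟩
end
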